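/- Let n ≥ 3 and let A : ℝⁿ → ℝⁿ be continuous. Then for every u ∈ C_c^∞(ℝⁿ;ℂ), ∫_{ℝⁿ} |u(x)|²/|x|² dx ≤ (4/(n−2)²) ∫_{ℝⁿ} |∇u(x) − iA(x)u(x)|² dx. -/

import Mathlib

open MeasureTheory Metric Real Set

noncomputable section

abbrev Euc (n : ℕ) := EuclideanSpace ℝ (Fin n)

/-- The magnetic (distorted) gradient `∇_A u = ∇u - iAu`, componentwise. -/
def mgrad {n : ℕ} (A : Euc n → Euc n) (u : Euc n → ℂ) (x : Euc n) (j : Fin n) : ℂ :=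
  fderiv ℝ u x (EuclideanSpace.single j 1) - Complex.I * (A x j : ℝ) * u x

/-- `|∇_A u|² = |∇u - iAu|²`. -/
def mgradNormSq {n : ℕ} (A : Euc n → Euc n) (u : Euc n → ℂ) (x : Euc n) : ℝ :=
  ∑ j : Fin n, ‖mgrad A u x j‖ ^ 2

lemma integral_fderiv_zero {n : ℕ} (g : Euc n → ℝ) (hg : ContDiff ℝ 1 g)
    (hs : HasCompactSupport g) (v : Euc n) :
    Integrable (fun x => fderiv ℝ g x v) ∧ ∫ x, fderiv ℝ g x v = 0 := by
  have hint : Integrable (fun x => fderiv ℝ g x v) :=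
    ((hg.continuous_fderiv one_ne_zero).clm_apply continuous_const).integrable_of_hasCompactSupport
      (hs.fderiv_apply (𝕜 := ℝ) v)
  refine ⟨hint, ?_⟩
  have h := integral_mul_fderiv_eq_neg_fderiv_mul_of_integrable (𝕜 := ℝ)
    (μ := (volume : Measure (Euc n))) (f := fun _ => (1 : ℝ)) (g := g) (v := v)
    (by simp) (by simpa using hint)
    (by simpa using hg.continuous.integrable_of_hasCompactSupport hs)
    (fun x _ => differentiableAt_const _)
    (fun x _ => (hg.differentiable one_ne_zero) x)
  simpa using h

/-- The `j`-th component of the regularised vector field. -/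
def hF {n : ℕ} (u : Euc n → ℂ) (ε : ℝ) (j : Fin n) (x : Euc n) : ℝ :=
  x j * ((‖x‖ ^ 2 + ε)⁻¹ * ‖u x‖ ^ 2)

lemma hF_contDiff {n : ℕ} (u : Euc n → ℂ) (hu : ContDiff ℝ 1 u) {ε : ℝ} (hε : 0 < ε)
    (j : Fin n) : ContDiff ℝ 1 (hF u ε j) := by
  unfold hF
  have h1 : ContDiff ℝ 1 (fun x : Euc n => x j) :=
    (EuclideanSpace.proj j : Euc n →L[ℝ] ℝ).contDiff
  have h2 : ContDiff ℝ 1 (fun x : Euc n => (‖x‖ ^ 2 + ε)⁻¹) :=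
    ((contDiff_norm_sq ℝ).add contDiff_const).inv (fun x => by positivity)
  exact h1.mul (h2.mul (hu.norm_sq ℝ))

lemma hF_fderiv {n : ℕ} (u : Euc n → ℂ) (hu : ContDiff ℝ 1 u) {ε : ℝ} (hε : 0 < ε)
    (j : Fin n) (x : Euc n) : fderiv ℝ (hF u ε j) x (EuclideanSpace.single j 1) =
      ((‖x‖ ^ 2 + ε)⁻¹ - 2 * (x j) ^ 2 * ((‖x‖ ^ 2 + ε)⁻¹) ^ 2) * ‖u x‖ ^ 2 +
      x j * (‖x‖ ^ 2 + ε)⁻¹ *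
        (2 * inner ℝ (u x) (fderiv ℝ u x (EuclideanSpace.single j 1))) := by
  have hne : ‖x‖ ^ 2 + ε ≠ 0 := by positivity
  have h1 : HasFDerivAt (fun x : Euc n => x j)
      (EuclideanSpace.proj j : Euc n →L[ℝ] ℝ) x :=
    (EuclideanSpace.proj j : Euc n →L[ℝ] ℝ).hasFDerivAt
  have h0 : HasFDerivAt (fun x : Euc n => ‖x‖ ^ 2 + ε) (2 • (innerSL ℝ x)) x :=
    (hasStrictFDerivAt_norm_sq x).hasFDerivAt.add_const ε
  have h2 := (hasDerivAt_inv hne).comp_hasFDerivAt x h0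
  have h3 := ((hu.differentiable one_ne_zero) x).hasFDerivAt.norm_sq
  have h := h1.mul (h2.mul h3)
  have h' : HasFDerivAt (hF u ε j) _ x := h
  rw [h'.fderiv]
  simp [EuclideanSpace.inner_single_right]
  field_simp
  ring

lemma pointwise {n : ℕ} (A : Euc n → Euc n) (u : Euc n → ℂ) (x : Euc n) (j : Fin n) (c t : ℝ)
    (hc : 0 < c) :
    -(c * (t ^ 2 * ‖u x‖ ^ 2) + ‖mgrad A u x j‖ ^ 2 / c) ≤
      t * (2 * inner ℝ (u x) (fderiv ℝ u x (EuclideanSpace.single j 1))) := by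
  have h1 : inner ℝ (u x) (fderiv ℝ u x (EuclideanSpace.single j 1))
      = inner ℝ (u x) (mgrad A u x j) := by
    unfold mgrad
    simp [Complex.inner]
    ring
  rw [h1]
  have h2 := abs_real_inner_le_norm (u x) (mgrad A u x j)
  have h3 : -(|t| * (‖u x‖ * ‖mgrad A u x j‖)) ≤ t * inner ℝ (u x) (mgrad A u x j) := by
    have := mul_le_mul_of_nonneg_left h2 (abs_nonneg t)
    rw [← abs_mul] at this
    have := neg_abs_le (t * inner ℝ (u x) (mgrad A u x j))
    linarith
  have h4 : 2 * (|t| * (‖u x‖ * ‖mgrad A u x j‖)) ≤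
      c * (t ^ 2 * ‖u x‖ ^ 2) + ‖mgrad A u x j‖ ^ 2 / c := by
    rw [← sq_abs t]
    have : c * (|t| ^ 2 * ‖u x‖ ^ 2) + ‖mgrad A u x j‖ ^ 2 / c
      - 2 * (|t| * (‖u x‖ * ‖mgrad A u x j‖)) = (c * |t| * ‖u x‖ - ‖mgrad A u x j‖) ^ 2 / c := by
      field_simp
      ring
    have : 0 ≤ (c * |t| * ‖u x‖ - ‖mgrad A u x j‖) ^ 2 / c := by positivity
    linarith
  linarith

lemma sum_bound {n : ℕ} (hn : 3 ≤ n) (A : Euc n → Euc n) (u : Euc n → ℂ)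
    (hu : ContDiff ℝ 1 u) {ε : ℝ} (hε : 0 < ε) (x : Euc n) :
    ((n : ℝ) - 2) / 2 * (‖u x‖ ^ 2 / (‖x‖ ^ 2 + ε)) - 2 / ((n : ℝ) - 2) * mgradNormSq A u x ≤
      ∑ j, fderiv ℝ (hF u ε j) x (EuclideanSpace.single j 1) := by
  have hn' : (3 : ℝ) ≤ n := by exact_mod_cast hn
  set c : ℝ := ((n : ℝ) - 2) / 2 with hc
  have hcpos : 0 < c := by rw [hc]; linarith
  set s := (‖x‖ ^ 2 + ε)⁻¹ with hs
  have hspos : 0 < s := by positivity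
  have key : ∀ j, (s - (2 + c) * (x j) ^ 2 * s ^ 2) * ‖u x‖ ^ 2 - ‖mgrad A u x j‖ ^ 2 / c ≤
      fderiv ℝ (hF u ε j) x (EuclideanSpace.single j 1) := by
    intro j
    rw [hF_fderiv u hu hε j x, ← hs]
    have := pointwise A u x j c (x j * s) hcpos
    nlinarith
  refine le_trans ?_ (Finset.sum_le_sum fun j _ => key j)
  have hx : ∑ j, (x j) ^ 2 = ‖x‖ ^ 2 := by
    rw [EuclideanSpace.norm_sq_eq]; simp
  have e : ∑ j, ((s - (2 + c) * (x j) ^ 2 * s ^ 2) * ‖u x‖ ^ 2 - ‖mgrad A u x j‖ ^ 2 / c)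
      = (n * s - (2 + c) * ‖x‖ ^ 2 * s ^ 2) * ‖u x‖ ^ 2 - mgradNormSq A u x / c := by
    unfold mgradNormSq
    rw [Finset.sum_sub_distrib, ← Finset.sum_mul, Finset.sum_sub_distrib, ← Finset.sum_mul,
      ← Finset.mul_sum, ← Finset.sum_div, hx]
    simp
  rw [e]
  have h1 : ‖x‖ ^ 2 * s ^ 2 ≤ s := by
    have : (‖x‖ ^ 2 + ε) * s = 1 := by rw [hs]; field_simp
    have : 0 < ε * s := by positivity
    nlinarith
  have h2 : 2 / ((n : ℝ) - 2) = 1 / c := by rw [hc]; field_simp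
  rw [h2, div_eq_mul_inv (‖u x‖ ^ 2), ← hs]
  have h3 : c * s ≤ n * s - (2 + c) * ‖x‖ ^ 2 * s ^ 2 := by
    have : (n : ℝ) = 2 + 2 * c := by rw [hc]; ring
    rw [this]
    nlinarith
  have h4 := mul_le_mul_of_nonneg_right h3 (sq_nonneg ‖u x‖)
  have h5 : 1 / c * mgradNormSq A u x = mgradNormSq A u x / c := by ring
  rw [h5]
  linarith

lemma mgradNormSq_integrable {n : ℕ} (A : Euc n → Euc n) (hA : Continuous A)
    (u : Euc n → ℂ) (hu : ContDiff ℝ 1 u) (husupp : HasCompactSupport u) :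
    Integrable (fun x => mgradNormSq A u x) := by
  unfold mgradNormSq
  refine integrable_finsetSum _ fun j _ => ?_
  have hc : Continuous (fun x => mgrad A u x j) := by
    unfold mgrad
    have h1 := (hu.continuous_fderiv one_ne_zero).clm_apply
      (continuous_const (y := (EuclideanSpace.single j 1 : Euc n)))
    have h2 : Continuous fun x => A x j :=
      (EuclideanSpace.proj j : Euc n →L[ℝ] ℝ).continuous.comp hA
    exact h1.sub ((continuous_const.mul (Complex.continuous_ofReal.comp h2)).mul hu.continuous)
  have hs : HasCompactSupport (fun x => mgrad A u x j) := by
    have a : HasCompactSupport (fun x => fderiv ℝ u x (EuclideanSpace.single j 1)) :=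
      husupp.fderiv_apply (𝕜 := ℝ) _
    have b : HasCompactSupport (fun x => Complex.I * (A x j : ℝ) * u x) :=
      HasCompactSupport.mul_left (f := fun x => Complex.I * ((A x j : ℝ) : ℂ)) husupp
    exact a.sub b
  have hs2 : HasCompactSupport (fun x => ‖mgrad A u x j‖ ^ 2) :=
    hs.comp_left (g := fun z : ℂ => ‖z‖ ^ 2) (by simp)
  have hc2 : Continuous (fun x => ‖mgrad A u x j‖ ^ 2) := hc.norm.pow 2
  exact hc2.integrable_of_hasCompactSupport hs2

lemma hardy_eps {n : ℕ} (hn : 3 ≤ n) (A : Euc n → Euc n) (hA : Continuous A)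
    (u : Euc n → ℂ) (hu : ContDiff ℝ 1 u) (husupp : HasCompactSupport u) {ε : ℝ} (hε : 0 < ε) :
    ∫ x, ‖u x‖ ^ 2 / (‖x‖ ^ 2 + ε) ≤ 4 / ((n : ℝ) - 2) ^ 2 * ∫ x, mgradNormSq A u x := by
  have hn' : (3 : ℝ) ≤ n := by exact_mod_cast hn
  have hsq : HasCompactSupport (fun x => ‖u x‖ ^ 2) :=
    husupp.comp_left (g := fun z : ℂ => ‖z‖ ^ 2) (by simp)
  have hI : Integrable (fun x : Euc n => ‖u x‖ ^ 2 / (‖x‖ ^ 2 + ε)) := by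
    refine Continuous.integrable_of_hasCompactSupport ?_ ?_
    · exact (hu.continuous.norm.pow 2).div (by fun_prop) (fun x => by positivity)
    · simp only [div_eq_mul_inv]
      exact hsq.mul_right
  have hG := mgradNormSq_integrable A hA u hu husupp
  have hz : ∀ j, Integrable (fun x => fderiv ℝ (hF u ε j) x (EuclideanSpace.single j 1)) ∧
      ∫ x, fderiv ℝ (hF u ε j) x (EuclideanSpace.single j 1) = 0 := fun j =>
    integral_fderiv_zero _ (hF_contDiff u hu hε j) (by unfold hF; exact (hsq.mul_left).mul_left) _
  have h0 : ∫ x, ∑ j, fderiv ℝ (hF u ε j) x (EuclideanSpace.single j 1) = 0 := by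
    rw [integral_finsetSum _ fun j _ => (hz j).1]
    exact Finset.sum_eq_zero fun j _ => (hz j).2
  have hm := integral_mono ((hI.const_mul (((n : ℝ) - 2) / 2)).sub (hG.const_mul (2 / ((n : ℝ) - 2))))
    (integrable_finsetSum _ fun j _ => (hz j).1) (sum_bound hn A u hu hε)
  rw [h0] at hm
  simp only [Pi.sub_apply] at hm
  rw [integral_sub (hI.const_mul _) (hG.const_mul _), integral_const_mul, integral_const_mul] at hm
  set I := ∫ x, ‖u x‖ ^ 2 / (‖x‖ ^ 2 + ε)
  set G := ∫ x, mgradNormSq A u x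
  have hd : 0 < (n : ℝ) - 2 := by linarith
  have e : 4 / ((n : ℝ) - 2) ^ 2 * G - I =
    -(2 / ((n : ℝ) - 2)) * (((n : ℝ) - 2) / 2 * I - 2 / ((n : ℝ) - 2) * G) := by
    field_simp
    ring
  have : 0 ≤ (2 / ((n : ℝ) - 2)) * -(((n : ℝ) - 2) / 2 * I - 2 / ((n : ℝ) - 2) * G) :=
    mul_nonneg (by positivity) (by linarith)
  linarith

/-- **Magnetic Hardy inequality (1.20)**: for `n ≥ 3` and `u ∈ C_c^∞(ℝⁿ;ℂ)`,
`∫ |u|²/|x|² dx ≤ (4/(n-2)²) ∫ |∇u - iAu|² dx`. -/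
theorem magnetic_hardy
    (n : ℕ) (hn : 3 ≤ n) (A : Euc n → Euc n) (hA : Continuous A)
    (u : Euc n → ℂ) (hu : ContDiff ℝ (⊤ : ℕ∞) u) (husupp : HasCompactSupport u) :
    ∫ x, ‖u x‖ ^ 2 / ‖x‖ ^ 2 ≤ 4 / ((n : ℝ) - 2) ^ 2 * ∫ x, mgradNormSq A u x := by
  have hu1 : ContDiff ℝ 1 u := hu.of_le (by exact_mod_cast le_top)
  by_cases hint : Integrable (fun x : Euc n => ‖u x‖ ^ 2 / ‖x‖ ^ 2)
  swap
  · rw [integral_undef hint]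
    refine mul_nonneg (by positivity) (integral_nonneg fun x => ?_)
    exact Finset.sum_nonneg fun j _ => by positivity
  have : Nonempty (Fin n) := ⟨⟨0, by omega⟩⟩
  have hne : ∀ᵐ x : Euc n, x ≠ 0 := by
    simp [ae_iff]
  have hlim : Filter.Tendsto (fun k : ℕ => ∫ x : Euc n, ‖u x‖ ^ 2 / (‖x‖ ^ 2 + 1 / ((k : ℝ) + 1)))
      Filter.atTop (nhds (∫ x : Euc n, ‖u x‖ ^ 2 / ‖x‖ ^ 2)) := by
    refine tendsto_integral_of_dominated_convergence _ (fun k => ?_) hint (fun k => ?_) ?_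
    · refine Continuous.aestronglyMeasurable ?_
      exact (hu.continuous.norm.pow 2).div (by fun_prop) (fun x => by positivity)
    · filter_upwards [hne] with x hx
      have : 0 < ‖x‖ := norm_pos_iff.2 hx
      rw [Real.norm_of_nonneg (by positivity)]
      gcongr
      have : 0 < 1 / ((k : ℝ) + 1) := by positivity
      linarith
    · filter_upwards [hne] with x hx
      have : 0 < ‖x‖ := norm_pos_iff.2 hx
      refine Filter.Tendsto.div tendsto_const_nhds ?_ (by positivity)
      simpa using (tendsto_one_div_add_atTop_nhds_zero_nat (𝕜 := ℝ)).const_add (‖x‖ ^ 2)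
  exact le_of_tendsto' hlim fun k => hardy_eps hn A hA u hu1 husupp (by positivity)
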